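/- arXiv:1312.3688 — 2 statements merged into one kernel-verified Lean document; each statement's English description precedes it below -/
import Mathlib

section
/- Fix χ, m, q, c > 0. Let ψ̊ : [0,∞) → (0,∞) be C² with x ↦ ψ̊(|x|) twice continuously differentiable and square integrable on ℝ³, solving the steady-state equation Δ(ψ̊(|x|)) = G′(ψ̊(|x|)²) ψ̊(|x|) on ℝ³. In the moving-frame variable y = x − r(t), let the potentials be φ(t,x) = φ₀(t) + y·φ₁(t) + φ₂(t,y) and A(t,x) = A₀(t) + A₁(t)y + ∇_yP₃(t,y), where φ₀, φ₁, A₀ are C¹ functions of t, A₁(t) is a 3×3 real matrix depending C¹ on t, P₃(t,·) is for each t a positively homogeneous polynomial-type function of degree 3 in y with ∇_yP₃ continuously differentiable in (t,y), and φ₂(t,y) = −(q/(2mc²))|Ă(t,y)|² − (1/c)∂_t(P₂(t,y) + P₃(t,y)) + (1/c)v(t)·∇_yP₃(t,y), with Ă(t,y) = (1/2)(A₁(t) − A₁(t)ᵀ)y and P₂(t,y) = (1/2) y·A₁(t)y. Let r : ℝ → ℝ³ be C² with v = ∂_t r satisfying Newton's law m ∂_t²r(t) = q E(t,r(t)) +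 (q/c) v(t) × B(t,r(t)), where E = −∇φ − (1/c)∂_tA, B = ∇×A. Define the phase S(t,y) = (m/χ) v(t)·y + (q/(χc)) y·A₀(t) + s_p(t) + s_{p2}(t,y), where s_p(t) = (1/χ)∫₀^t [ (1/2)m|v|² + (q/c)v·A₀ − qφ₀ ] dt′ and s_{p2}(t,y) = (q/(2χc)) y·A₁(t)y + (q/(3χc)) y·∇_yP₃(t,y). Then the wave-corpuscle ψ(t,x) = e^{iS(t, x−r(t))} ψ̊(|x − r(t)|) is an exact solution of the NLS equation i∂̃_tψ = (χ/(2m))(−∇̃²ψ + G′(|ψ|²)ψ) with these potentials, for all (t,x). -/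
noncomputable section

open MeasureTheory Complex Filter Topology Metric

/-- Physical space `ℝ³` with the Euclidean metric. -/
abbrev V3 : Type := EuclideanSpace ℝ (Fin 3)

/-- Dot product of two triples of reals. -/
def dot3 (v w : Fin 3 → ℝ) : ℝ := ∑ i, v i * w i

/-- Cross product in `ℝ³`. -/
def cross3 (v w : Fin 3 → ℝ) : Fin 3 → ℝ :=
  ![v 1 * w 2 - v 2 * w 1, v 2 * w 0 - v 0 * w 2, v 0 * w 1 - v 1 * w 0]

/-- Matrix (as nested function) applied to a vector. -/
def matVec (M : Fin 3 → Fin 3 → ℝ) (v : Fin 3 → ℝ) : Fin 3 → ℝ := fun j => ∑ i, M j i * v i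

/-- Partial derivative in time of a function of `(t, x)`. -/
def ptD {F : Type} [NormedAddCommGroup F] [NormedSpace ℝ F]
    (f : ℝ × V3 → F) (p : ℝ × V3) : F := fderiv ℝ f p (1, 0)

/-- Partial derivative in the `i`-th spatial direction of a function of `(t, x)`. -/
def pxD {F : Type} [NormedAddCommGroup F] [NormedSpace ℝ F]
    (i : Fin 3) (f : ℝ × V3 → F) (p : ℝ × V3) : F :=
  fderiv ℝ f p (0, EuclideanSpace.single i 1)

/-- Partial derivative in the `i`-th direction of a function on space only. -/
def pxS {F : Type} [NormedAddCommGroup F] [NormedSpace ℝ F]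
    (i : Fin 3) (f : V3 → F) (x : V3) : F :=
  fderiv ℝ f x (EuclideanSpace.single i 1)

/-- Laplacian of a scalar function on `ℝ³`. -/
def lap3 (f : V3 → ℝ) (x : V3) : ℝ := ∑ i, pxS i (pxS i f) x

/-- Covariant time derivative `∂̃_t = ∂_t + i (q/χ) φ`. -/
def covT (χ q : ℝ) (φ : ℝ × V3 → ℝ) (ψ : ℝ × V3 → ℂ) (p : ℝ × V3) : ℂ :=
  ptD ψ p + Complex.I * ((q / χ : ℝ) : ℂ) * ((φ p : ℝ) : ℂ) * ψ p

/-- Covariant spatial derivative `∂̃_i = ∂_i − i (q/(χc)) A_i`. -/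
def covX (χ q c : ℝ) (A : ℝ × V3 → Fin 3 → ℝ) (i : Fin 3)
    (ψ : ℝ × V3 → ℂ) (p : ℝ × V3) : ℂ :=
  pxD i ψ p - Complex.I * ((q / (χ * c) : ℝ) : ℂ) * ((A p i : ℝ) : ℂ) * ψ p

/-- The NLS equation `i ∂̃_t ψ = (χ/(2m)) ( −∇̃²ψ + G'_a(|ψ|²) ψ )` at a point,
with the scaled nonlinearity `G'_a(s) = a⁻² G'₁(a³ s)`. -/
def SatisfiesNLS (χ m q c a : ℝ) (G1' : ℝ → ℝ) (φ : ℝ × V3 → ℝ)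
    (A : ℝ × V3 → Fin 3 → ℝ) (ψ : ℝ × V3 → ℂ) (p : ℝ × V3) : Prop :=
  Complex.I * covT χ q φ ψ p =
    ((χ / (2 * m) : ℝ) : ℂ) *
      (-(∑ i, covX χ q c A i (covX χ q c A i ψ) p) +
        (((a ^ (2 : ℕ))⁻¹ * G1' (a ^ (3 : ℕ) * Complex.normSq (ψ p)) : ℝ) : ℂ) * ψ p)

/-- The NLS equation with an unscaled nonlinearity `G'`. -/
def SatisfiesNLS' (χ m q c : ℝ) (G' : ℝ → ℝ) (φ : ℝ × V3 → ℝ)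
    (A : ℝ × V3 → Fin 3 → ℝ) (ψ : ℝ × V3 → ℂ) (p : ℝ × V3) : Prop :=
  Complex.I * covT χ q φ ψ p =
    ((χ / (2 * m) : ℝ) : ℂ) *
      (-(∑ i, covX χ q c A i (covX χ q c A i ψ) p) +
        ((G' (Complex.normSq (ψ p)) : ℝ) : ℂ) * ψ p)

/-- Charge density `ρ = q |ψ|²`. -/
def rhoD (q : ℝ) (ψ : ℝ × V3 → ℂ) (p : ℝ × V3) : ℝ := q * Complex.normSq (ψ p)

/-- Current density `J = −i (qχ/(2m)) (ψ* ∇̃ψ − ψ (∇̃ψ)*)`. -/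
def JD (χ m q c : ℝ) (A : ℝ × V3 → Fin 3 → ℝ) (ψ : ℝ × V3 → ℂ)
    (p : ℝ × V3) : Fin 3 → ℝ := fun i =>
  (-Complex.I * ((q * χ / (2 * m) : ℝ) : ℂ) *
    ((starRingEnd ℂ) (ψ p) * covX χ q c A i ψ p
      - ψ p * (starRingEnd ℂ) (covX χ q c A i ψ p))).re

/-- Momentum density `P = (iχ/2) (ψ (∇̃ψ)* − ψ* ∇̃ψ)`. -/
def PD (χ q c : ℝ) (A : ℝ × V3 → Fin 3 → ℝ) (ψ : ℝ × V3 → ℂ)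
    (p : ℝ × V3) : Fin 3 → ℝ := fun i =>
  (Complex.I * ((χ / 2 : ℝ) : ℂ) *
    (ψ p * (starRingEnd ℂ) (covX χ q c A i ψ p)
      - (starRingEnd ℂ) (ψ p) * covX χ q c A i ψ p)).re

/-- Energy density `u = (χ²/(2m)) ( |∇̃ψ|² + G_a(|ψ|²) )` for an antiderivative `Ga`. -/
def uD (χ m q c : ℝ) (Ga : ℝ → ℝ) (A : ℝ × V3 → Fin 3 → ℝ) (ψ : ℝ × V3 → ℂ)
    (p : ℝ × V3) : ℝ :=
  (χ ^ 2 / (2 * m)) * ((∑ i, Complex.normSq (covX χ q c A i ψ p)) + Ga (Complex.normSq (ψ p)))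

/-- Entries `T^{ij}` of the energy–momentum (stress) tensor of the NLS. -/
def TD (χ m q c : ℝ) (Ga : ℝ → ℝ) (φ : ℝ × V3 → ℝ) (A : ℝ × V3 → Fin 3 → ℝ)
    (ψ : ℝ × V3 → ℂ) (i j : Fin 3) (p : ℝ × V3) : ℝ :=
  if i = j then
    uD χ m q c Ga A ψ p - (χ ^ 2 / m) * Complex.normSq (covX χ q c A i ψ p)
      + (Complex.I * ((χ / 2 : ℝ) : ℂ) *
          (ψ p * (starRingEnd ℂ) (covT χ q φ ψ p)
            - (starRingEnd ℂ) (ψ p) * covT χ q φ ψ p)).re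
  else
    (-(((χ ^ 2 / (2 * m) : ℝ)) : ℂ) *
        (covX χ q c A i ψ p * (starRingEnd ℂ) (covX χ q c A j ψ p)
          + covX χ q c A j ψ p * (starRingEnd ℂ) (covX χ q c A i ψ p))).re

/-- Electric field `E = −∇φ − (1/c) ∂_t A`. -/
def ED (c : ℝ) (φ : ℝ × V3 → ℝ) (A : ℝ × V3 → Fin 3 → ℝ) (p : ℝ × V3) : Fin 3 → ℝ :=
  fun i => -(pxD i φ p) - (1 / c) * ptD A p i

/-- Magnetic field `B = ∇ × A`. -/
def BD (A : ℝ × V3 → Fin 3 → ℝ) (p : ℝ × V3) : Fin 3 → ℝ :=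
  ![pxD 1 A p 2 - pxD 2 A p 1, pxD 2 A p 0 - pxD 0 A p 2, pxD 0 A p 1 - pxD 1 A p 0]

/-- Lorentz force density `f = ρ E + (1/c) J × B`. -/
def fD (χ m q c : ℝ) (φ : ℝ × V3 → ℝ) (A : ℝ × V3 → Fin 3 → ℝ) (ψ : ℝ × V3 → ℂ)
    (p : ℝ × V3) : Fin 3 → ℝ := fun j =>
  rhoD q ψ p * ED c φ A p j + (1 / c) * cross3 (JD χ m q c A ψ p) (BD A p) j

/-- A tubular neighborhood `Ω̂` of a trajectory. -/
def Tube (Tm Tp : ℝ) (r : ℝ → V3) (R : ℝ) : Set (ℝ × V3) :=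
  {p | p.1 ∈ Set.Icc Tm Tp ∧ ‖p.2 - r p.1‖ ≤ R}

/-- Outward unit normal on the sphere of radius `R` centered at `ctr`. -/
def nrm (ctr : V3) (R : ℝ) (x : V3) : Fin 3 → ℝ := fun i => (x i - ctr i) / R

/-- A trajectory: a `C²` curve with bounded first and second derivatives on `[T₋, T₊]`. -/
def IsTrajectory (Tm Tp : ℝ) (r : ℝ → V3) : Prop :=
  ContDiff ℝ 2 r ∧ ∃ C : ℝ, ∀ t ∈ Set.Icc Tm Tp, ‖deriv r t‖ ≤ C ∧ ‖deriv (deriv r) t‖ ≤ C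

/-- Adjacent (restricted) charge value `ρ̄_n(t)`. -/
def rbar (q : ℝ) (rhat : ℝ → V3) (R : ℕ → ℝ) (ψ : ℕ → ℝ × V3 → ℂ) (n : ℕ) (t : ℝ) : ℝ :=
  ∫ x in closedBall (rhat t) (R n), rhoD q (ψ n) (t, x)

/-- Adjacent charge center `r_n(t)`. -/
def rcen (q : ℝ) (rhat : ℝ → V3) (R : ℕ → ℝ) (ψ : ℕ → ℝ × V3 → ℂ) (n : ℕ) (t : ℝ) : V3 :=
  (rbar q rhat R ψ n t)⁻¹ • ∫ x in closedBall (rhat t) (R n), rhoD q (ψ n) (t, x) • x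

/-- Velocity of the adjacent charge center. -/
def vcen (Tm Tp q : ℝ) (rhat : ℝ → V3) (R : ℕ → ℝ) (ψ : ℕ → ℝ × V3 → ℂ)
    (n : ℕ) (t : ℝ) : V3 :=
  derivWithin (rcen q rhat R ψ n) (Set.Icc Tm Tp) t

end

noncomputable section
open MeasureTheory Complex Filter Topology Metric

/-- Sphere-tangent (antisymmetric) part `Ă(t,y) = (1/2)(A₁ − A₁ᵀ) y`. -/
def breveA (A1 : ℝ → Fin 3 → Fin 3 → ℝ) (t : ℝ) (y : Fin 3 → ℝ) : Fin 3 → ℝ :=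
  fun j => (1 / 2) * ∑ i, (A1 t j i - A1 t i j) * y i

/-- Quadratic potential `P₂(t,y) = (1/2) y · A₁(t) y`. -/
def P2q (A1 : ℝ → Fin 3 → Fin 3 → ℝ) (t : ℝ) (y : Fin 3 → ℝ) : ℝ :=
  (1 / 2) * dot3 y (matVec (A1 t) y)

/-- Compatible quadratic part `φ₂` of the electric potential of a wave-corpuscle. -/
def phi2WC (m q c : ℝ) (r : ℝ → V3) (A1 : ℝ → Fin 3 → Fin 3 → ℝ)
    (P3 : ℝ → V3 → ℝ) (t : ℝ) (y : V3) : ℝ :=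
  -(q / (2 * m * c ^ 2)) * (∑ i, (breveA A1 t (fun i => y i) i) ^ 2)
    - (1 / c) * deriv (fun s => P2q A1 s (fun i => y i) + P3 s y) t
    + (1 / c) * dot3 (fun i => deriv r t i) (fun j => pxS j (P3 t) y)

/-- The electric potential `φ(t,x) = φ₀(t) + y·φ₁(t) + φ₂(t,y)`, `y = x − r(t)`. -/
def phiWC (m q c : ℝ) (r : ℝ → V3) (φ0 : ℝ → ℝ) (φ1 : ℝ → Fin 3 → ℝ)
    (A1 : ℝ → Fin 3 → Fin 3 → ℝ) (P3 : ℝ → V3 → ℝ) (p : ℝ × V3) : ℝ :=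
  φ0 p.1 + dot3 (fun i => p.2 i - r p.1 i) (φ1 p.1)
    + phi2WC m q c r A1 P3 p.1 (p.2 - r p.1)

/-- The magnetic potential `A(t,x) = A₀(t) + A₁(t) y + ∇_y P₃(t,y)`, `y = x − r(t)`. -/
def AWC (r : ℝ → V3) (A0 : ℝ → Fin 3 → ℝ) (A1 : ℝ → Fin 3 → Fin 3 → ℝ)
    (P3 : ℝ → V3 → ℝ) (p : ℝ × V3) : Fin 3 → ℝ := fun j =>
  A0 p.1 j + matVec (A1 p.1) (fun i => p.2 i - r p.1 i) j + pxS j (P3 p.1) (p.2 - r p.1)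

/-- The purely time-dependent part `s_p(t)` of the phase of a wave-corpuscle. -/
def spWC (χ m q c : ℝ) (r : ℝ → V3) (φ0 : ℝ → ℝ) (A0 : ℝ → Fin 3 → ℝ) (t : ℝ) : ℝ :=
  χ⁻¹ * ∫ t' in (0 : ℝ)..t,
    ((1 / 2) * m * (∑ i, (deriv r t' i) ^ 2)
      + (q / c) * dot3 (fun i => deriv r t' i) (A0 t') - q * φ0 t')

/-- The higher-order part `s_{p2}(t,y)` of the phase of a wave-corpuscle. -/
def sp2WC (χ q c : ℝ) (A1 : ℝ → Fin 3 → Fin 3 → ℝ) (P3 : ℝ → V3 → ℝ)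
    (t : ℝ) (y : V3) : ℝ :=
  (q / (2 * χ * c)) * dot3 (fun i => y i) (matVec (A1 t) (fun i => y i))
    + (q / (3 * χ * c)) * dot3 (fun i => y i) (fun j => pxS j (P3 t) y)

/-- The phase `S(t,y)` of a wave-corpuscle. -/
def SWC (χ m q c : ℝ) (r : ℝ → V3) (φ0 : ℝ → ℝ) (A0 : ℝ → Fin 3 → ℝ)
    (A1 : ℝ → Fin 3 → Fin 3 → ℝ) (P3 : ℝ → V3 → ℝ) (t : ℝ) (y : V3) : ℝ :=
  (m / χ) * dot3 (fun i => deriv r t i) (fun i => y i)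
    + (q / (χ * c)) * dot3 (fun i => y i) (A0 t)
    + spWC χ m q c r φ0 A0 t + sp2WC χ q c A1 P3 t y

/-- The wave-corpuscle `ψ(t,x) = e^{i S(t, x − r(t))} ψ̊(|x − r(t)|)`. -/
def psiWC (χ m q c : ℝ) (r : ℝ → V3) (φ0 : ℝ → ℝ) (A0 : ℝ → Fin 3 → ℝ)
    (A1 : ℝ → Fin 3 → Fin 3 → ℝ) (P3 : ℝ → V3 → ℝ) (ψ0 : ℝ → ℝ) (p : ℝ × V3) : ℂ :=
  Complex.exp (Complex.I * ((SWC χ m q c r φ0 A0 A1 P3 p.1 (p.2 - r p.1) : ℝ) : ℂ))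
    * ((ψ0 ‖p.2 - r p.1‖ : ℝ) : ℂ)


/-! ### Helper lemmas -/

lemma wc_ptD_line {F : Type} [NormedAddCommGroup F] [NormedSpace ℝ F]
    {f : ℝ × V3 → F} {t : ℝ} {y : V3} (hf : DifferentiableAt ℝ f (t, y)) {d : F}
    (h : HasDerivAt (fun s => f (s, y)) d t) : ptD f (t, y) = d := by
  have h1 : HasDerivAt (fun s : ℝ => ((s, y) : ℝ × V3)) (1, 0) t :=
    (hasDerivAt_id t).prodMk (hasDerivAt_const t y)
  exact (hf.hasFDerivAt.comp_hasDerivAt t h1).unique h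

lemma wc_pxD_hasDerivAt {F : Type} [NormedAddCommGroup F] [NormedSpace ℝ F]
    {f : ℝ × V3 → F} {t : ℝ} {y : V3} (i : Fin 3) (hf : DifferentiableAt ℝ f (t, y)) :
    HasDerivAt (fun s : ℝ => f (t, y + s • EuclideanSpace.single i (1 : ℝ))) (pxD i f (t, y)) 0 := by
  have h1 : HasDerivAt (fun s : ℝ => ((t, y + s • EuclideanSpace.single i (1 : ℝ)) : ℝ × V3))
      (0, EuclideanSpace.single i 1) 0 := by
    have := (hasDerivAt_id (0 : ℝ)).smul_const (EuclideanSpace.single i (1 : ℝ))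
    refine (hasDerivAt_const (0 : ℝ) t).prodMk ?_
    simpa using this.const_add y
  have hf' : HasFDerivAt f (fderiv ℝ f (t, y))
      ((fun s : ℝ => ((t, y + s • EuclideanSpace.single i (1 : ℝ)) : ℝ × V3)) 0) := by
    simpa using hf.hasFDerivAt
  exact hf'.comp_hasDerivAt (0 : ℝ) h1

lemma wc_pxD_line {F : Type} [NormedAddCommGroup F] [NormedSpace ℝ F]
    {f : ℝ × V3 → F} {t : ℝ} {y : V3} (i : Fin 3) (hf : DifferentiableAt ℝ f (t, y)) {d : F}
    (h : HasDerivAt (fun s : ℝ => f (t, y + s • EuclideanSpace.single i (1 : ℝ))) d 0) :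
    pxD i f (t, y) = d :=
  (wc_pxD_hasDerivAt i hf).unique h

lemma wc_ptD_hasDerivAt {F : Type} [NormedAddCommGroup F] [NormedSpace ℝ F]
    {f : ℝ × V3 → F} {t : ℝ} {y : V3} (hf : DifferentiableAt ℝ f (t, y)) :
    HasDerivAt (fun s => f (s, y)) (ptD f (t, y)) t := by
  have h1 : HasDerivAt (fun s : ℝ => ((s, y) : ℝ × V3)) (1, 0) t :=
    (hasDerivAt_id t).prodMk (hasDerivAt_const t y)
  exact (hf.hasFDerivAt.comp_hasDerivAt t h1)

lemma wc_pxS_hasDerivAt {F : Type} [NormedAddCommGroup F] [NormedSpace ℝ F]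
    {f : V3 → F} {y : V3} (i : Fin 3) (hf : DifferentiableAt ℝ f y) :
    HasDerivAt (fun s : ℝ => f (y + s • EuclideanSpace.single i (1 : ℝ))) (pxS i f y) 0 := by
  have h1 : HasDerivAt (fun s : ℝ => (y + s • EuclideanSpace.single i (1 : ℝ) : V3))
      (EuclideanSpace.single i 1) 0 := by
    have := (hasDerivAt_id (0 : ℝ)).smul_const (EuclideanSpace.single i (1 : ℝ))
    simpa using this.const_add y
  have hf' : HasFDerivAt f (fderiv ℝ f y)
      ((fun s : ℝ => (y + s • EuclideanSpace.single i (1 : ℝ) : V3)) 0) := by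
    simpa using hf.hasFDerivAt
  exact hf'.comp_hasDerivAt (0 : ℝ) h1

lemma wc_fderiv_sum {F : Type} [NormedAddCommGroup F] [NormedSpace ℝ F]
    (L : V3 →L[ℝ] F) (w : V3) : L w = ∑ i, w i • L (EuclideanSpace.single i 1) := by
  have : w = ∑ i, w i • (EuclideanSpace.single i (1 : ℝ) : V3) := by
    ext j
    fin_cases j <;> simp [Fin.sum_univ_three]
  conv_lhs => rw [this]
  simp

lemma wc_chain {F : Type} [NormedAddCommGroup F] [NormedSpace ℝ F]
    {f : ℝ × V3 → F} {r : ℝ → V3} {t : ℝ} {x : V3} (hr : DifferentiableAt ℝ r t)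
    (hf : DifferentiableAt ℝ f (t, x - r t)) :
    DifferentiableAt ℝ (fun p : ℝ × V3 => f (p.1, p.2 - r p.1)) (t, x) ∧
    (ptD (fun p : ℝ × V3 => f (p.1, p.2 - r p.1)) (t, x)
      = ptD f (t, x - r t) - ∑ i, deriv r t i • pxD i f (t, x - r t)) ∧
    (∀ i, pxD i (fun p : ℝ × V3 => f (p.1, p.2 - r p.1)) (t, x) = pxD i f (t, x - r t)) := by
  have hY : HasFDerivAt (fun p : ℝ × V3 => ((p.1, p.2 - r p.1) : ℝ × V3))
      ((ContinuousLinearMap.fst ℝ ℝ V3).prod (ContinuousLinearMap.snd ℝ ℝ V3 -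
        (fderiv ℝ r t).comp (ContinuousLinearMap.fst ℝ ℝ V3))) (t, x) := by
    refine hasFDerivAt_fst.prodMk (hasFDerivAt_snd.sub ?_)
    exact HasFDerivAt.comp (t, x) (g := r) (hr.hasFDerivAt : HasFDerivAt r (fderiv ℝ r t) ((t, x) : ℝ × V3).1) hasFDerivAt_fst
  have hf' : HasFDerivAt f (fderiv ℝ f (t, x - r t))
      ((fun p : ℝ × V3 => ((p.1, p.2 - r p.1) : ℝ × V3)) (t, x)) := hf.hasFDerivAt
  have h := hf'.comp (t, x) hY
  have h2 : fderiv ℝ (fun p : ℝ × V3 => f (p.1, p.2 - r p.1)) (t, x) = _ := h.fderiv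
  refine ⟨h.differentiableAt, ?_, ?_⟩
  · unfold ptD pxD
    rw [h2]
    have e : ((1 : ℝ), -(deriv r t)) = ((1 : ℝ), (0 : V3)) - ((0:ℝ), deriv r t) := by simp
    have e2 := wc_fderiv_sum ((fderiv ℝ f (t, x - r t)).comp (ContinuousLinearMap.inr ℝ ℝ V3)) (deriv r t)
    simp only [ContinuousLinearMap.comp_apply, ContinuousLinearMap.inr_apply] at e2
    rw [← e2, ← map_sub, ← e]
    simp
  · intro i
    unfold pxD
    rw [h2]
    simp

lemma wc_mul_flat {a : ℝ × V3 → ℝ} {K : ℝ × V3 → ℝ} {p : ℝ × V3}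
    (ha : DifferentiableAt ℝ a p) (ha0 : a p = 0) (hK : ContinuousAt K p) (hK0 : K p = 0) :
    HasFDerivAt (fun z => a z * K z) (0 : ℝ × V3 →L[ℝ] ℝ) p := by
  rw [hasFDerivAt_iff_isLittleO]
  have h1 : (fun z => a z) =O[𝓝 p] (fun z => z - p) := by
    simpa [ha0] using ha.hasFDerivAt.isBigO_sub
  have h2 : K =o[𝓝 p] (fun _ => (1 : ℝ)) := by
    rw [Asymptotics.isLittleO_one_iff]
    simpa [ContinuousAt, hK0] using hK
  have h3 := h1.norm_right.mul_isLittleO h2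
  simpa [ha0] using h3

lemma wc_radial {ψ0 : ℝ → ℝ} (hs : Differentiable ℝ fun x : V3 => ψ0 ‖x‖) (y w : V3)
    (h : inner ℝ y w = 0) : ∑ i, w i * pxS i (fun x : V3 => ψ0 ‖x‖) y = 0 := by
  have e := wc_fderiv_sum (fderiv ℝ (fun x : V3 => ψ0 ‖x‖) y) w
  have key : fderiv ℝ (fun x : V3 => ψ0 ‖x‖) y w = 0 := by
    have hc : ∀ u : V3, HasDerivAt (fun s : ℝ => ψ0 ‖y + s • u‖)
        (fderiv ℝ (fun x : V3 => ψ0 ‖x‖) y u) 0 := by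
      intro u
      have h1 : HasDerivAt (fun s : ℝ => (y + s • u : V3)) u 0 := by
        have := (hasDerivAt_id (0 : ℝ)).smul_const u
        simpa using this.const_add y
      have hf' : HasFDerivAt (fun x : V3 => ψ0 ‖x‖) (fderiv ℝ (fun x : V3 => ψ0 ‖x‖) y)
          ((fun s : ℝ => (y + s • u : V3)) 0) := by
        simpa using (hs y).hasFDerivAt
      exact hf'.comp_hasDerivAt (0 : ℝ) h1
    have h1 := hc w
    have h2 := hc (-w)
    have h3 : (fun s : ℝ => ψ0 ‖y + s • (-w)‖) = fun s : ℝ => ψ0 ‖y + s • w‖ := by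
      funext s
      congr 1
      have : ‖y + s • (-w)‖ ^ 2 = ‖y + s • w‖ ^ 2 := by
        rw [norm_add_sq_real, norm_add_sq_real]
        simp [inner_smul_right, h, norm_smul]
      exact (sq_eq_sq₀ (norm_nonneg _) (norm_nonneg _)).1 this
    rw [h3] at h2
    have h4 := h1.unique h2
    rw [map_neg] at h4
    linarith
  rw [key] at e
  simpa [pxS] using e.symm

/-- Product with a phase. -/
lemma wc_covX_exp (χ q c : ℝ) (A : ℝ × V3 → Fin 3 → ℝ) (i : Fin 3) {S : ℝ × V3 → ℝ}
    {u : ℝ × V3 → ℂ} {p : ℝ × V3} (hS : DifferentiableAt ℝ S p) (hu : DifferentiableAt ℝ u p)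
    (W : ℝ) (hW : pxD i S p - q / (χ * c) * A p i = W) :
    covX χ q c A i (fun z => Complex.exp (Complex.I * ((S z : ℝ) : ℂ)) * u z) p
      = Complex.exp (Complex.I * ((S p : ℝ) : ℂ)) * (pxD i u p + Complex.I * (W : ℂ) * u p) := by
  have h1 : HasFDerivAt (fun z => ((S z : ℝ) : ℂ)) (Complex.ofRealCLM.comp (fderiv ℝ S p)) p :=
    Complex.ofRealCLM.hasFDerivAt.comp p hS.hasFDerivAt
  have h2 := ((h1.const_mul Complex.I).cexp).mul hu.hasFDerivAt
  have h3 : pxD i (fun z => Complex.exp (Complex.I * ((S z : ℝ) : ℂ)) * u z) p = _ :=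
    congrArg (fun L => L (0, EuclideanSpace.single i 1)) h2.fderiv
  unfold covX
  rw [h3, ← hW]
  simp [pxD]
  ring

lemma wc_ptD_exp {S : ℝ × V3 → ℝ}
    {u : ℝ × V3 → ℂ} {p : ℝ × V3} (hS : DifferentiableAt ℝ S p) (hu : DifferentiableAt ℝ u p) :
    DifferentiableAt ℝ (fun z => Complex.exp (Complex.I * ((S z : ℝ) : ℂ)) * u z) p ∧
    ptD (fun z => Complex.exp (Complex.I * ((S z : ℝ) : ℂ)) * u z) p
      = Complex.exp (Complex.I * ((S p : ℝ) : ℂ)) * (ptD u p + Complex.I * ((ptD S p : ℝ) : ℂ) * u p) ∧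
    ∀ i, pxD i (fun z => Complex.exp (Complex.I * ((S z : ℝ) : ℂ)) * u z) p
      = Complex.exp (Complex.I * ((S p : ℝ) : ℂ)) * (pxD i u p + Complex.I * ((pxD i S p : ℝ) : ℂ) * u p) := by
  have h1 : HasFDerivAt (fun z => ((S z : ℝ) : ℂ)) (Complex.ofRealCLM.comp (fderiv ℝ S p)) p :=
    Complex.ofRealCLM.hasFDerivAt.comp p hS.hasFDerivAt
  have h2 := ((h1.const_mul Complex.I).cexp).mul hu.hasFDerivAt
  have h3 : fderiv ℝ (fun z => Complex.exp (Complex.I * ((S z : ℝ) : ℂ)) * u z) p = _ :=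
    h2.fderiv
  refine ⟨h2.differentiableAt, ?_, fun i => ?_⟩
  · unfold ptD
    rw [h3]
    simp
    ring
  · unfold pxD
    rw [h3]
    simp
    ring

lemma wc_coord (i j : Fin 3) (y : V3) :
    HasDerivAt (fun s : ℝ => (y + s • EuclideanSpace.single i (1 : ℝ) : V3) j)
      (if j = i then 1 else 0) 0 := by
  have : (fun s : ℝ => (y + s • EuclideanSpace.single i (1 : ℝ) : V3) j)
      = fun s : ℝ => y j + s * (if j = i then 1 else 0) := by
    funext s
    simp [PiLp.single_apply]
  rw [this]
  simpa using ((hasDerivAt_id (0 : ℝ)).mul_const (if j = i then (1 : ℝ) else 0)).const_add (y j)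

section P3facts

variable {P3 : ℝ → V3 → ℝ}

lemma wc_P3_diff (hP3diff : Differentiable ℝ fun p : ℝ × V3 => P3 p.1 p.2) (t : ℝ) :
    Differentiable ℝ (P3 t) := by
  have : P3 t = (fun p : ℝ × V3 => P3 p.1 p.2) ∘ (fun y => (t, y)) := rfl
  rw [this]
  exact hP3diff.comp (by fun_prop)

lemma wc_P3_px (hP3diff : Differentiable ℝ fun p : ℝ × V3 => P3 p.1 p.2) (t : ℝ) (y : V3)
    (j : Fin 3) : pxD j (fun p : ℝ × V3 => P3 p.1 p.2) (t, y) = pxS j (P3 t) y :=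
  wc_pxD_line j (hP3diff _) (wc_pxS_hasDerivAt j (wc_P3_diff hP3diff t y))

lemma wc_P3_euler
    (hP3hom : ∀ t : ℝ, ∀ ζ > (0 : ℝ), ∀ y : V3, P3 t (ζ • y) = ζ ^ 3 * P3 t y)
    (hP3diff : Differentiable ℝ fun p : ℝ × V3 => P3 p.1 p.2) (t : ℝ) (y : V3) :
    ∑ j, y j * pxS j (P3 t) y = 3 * P3 t y := by
  have h1 : HasDerivAt (fun s : ℝ => (s • y : V3)) y 1 := by
    simpa using (hasDerivAt_id (1 : ℝ)).smul_const y
  have hf' : HasFDerivAt (P3 t) (fderiv ℝ (P3 t) y) ((fun s : ℝ => (s • y : V3)) 1) := by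
    simpa using (wc_P3_diff hP3diff t y).hasFDerivAt
  have h2 := hf'.comp_hasDerivAt (1 : ℝ) h1
  have h3 : HasDerivAt (fun s : ℝ => s ^ 3 * P3 t y) (3 * P3 t y) 1 := by
    simpa using (hasDerivAt_pow 3 (1 : ℝ)).mul_const (P3 t y)
  have h4 : (P3 t ∘ fun s : ℝ => (s • y : V3)) =ᶠ[𝓝 1] fun s : ℝ => s ^ 3 * P3 t y := by
    filter_upwards [lt_mem_nhds (zero_lt_one : (0 : ℝ) < 1)] with s hs
    exact hP3hom t s hs y
  have h5 := (h3.congr_of_eventuallyEq h4).unique h2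
  rw [h5, wc_fderiv_sum]
  simp [pxS]

lemma wc_g_hom
    (hP3hom : ∀ t : ℝ, ∀ ζ > (0 : ℝ), ∀ y : V3, P3 t (ζ • y) = ζ ^ 3 * P3 t y)
    (hP3diff : Differentiable ℝ fun p : ℝ × V3 => P3 p.1 p.2) (t : ℝ) (y : V3) (j : Fin 3)
    (ζ : ℝ) (hζ : 0 < ζ) : pxS j (P3 t) (ζ • y) = ζ ^ 2 * pxS j (P3 t) y := by
  have h1 : HasFDerivAt (fun y : V3 => ζ • y) (ζ • ContinuousLinearMap.id ℝ V3) y :=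
    (hasFDerivAt_id y).const_smul ζ
  have h2 := HasFDerivAt.comp y (wc_P3_diff hP3diff t (ζ • y)).hasFDerivAt h1
  have h3 : (P3 t ∘ fun y : V3 => ζ • y) = fun y => ζ ^ 3 * P3 t y := by
    funext y
    exact hP3hom t ζ hζ y
  rw [h3] at h2
  have h4 := h2.unique ((wc_P3_diff hP3diff t y).hasFDerivAt.const_mul (ζ ^ 3))
  have h5 := congrArg (fun L => L (EuclideanSpace.single j (1 : ℝ))) h4
  simp at h5
  unfold pxS
  have : ζ * (fderiv ℝ (P3 t) (ζ • y) (EuclideanSpace.single j 1))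
      = ζ * (ζ ^ 2 * fderiv ℝ (P3 t) y (EuclideanSpace.single j 1)) := by
    rw [h5]; ring
  exact mul_left_cancel₀ hζ.ne' this

lemma wc_g_zero
    (hP3hom : ∀ t : ℝ, ∀ ζ > (0 : ℝ), ∀ y : V3, P3 t (ζ • y) = ζ ^ 3 * P3 t y)
    (hP3diff : Differentiable ℝ fun p : ℝ × V3 => P3 p.1 p.2) (t : ℝ) (j : Fin 3) :
    pxS j (P3 t) 0 = 0 := by
  have := wc_g_hom hP3hom hP3diff t 0 j 2 (by norm_num)
  simp at this
  linarith

lemma wc_g_contDiff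
    (hgradP3 : ContDiff ℝ 1 fun p : ℝ × V3 => (fun j => pxS j (P3 p.1) p.2)) (j : Fin 3) :
    ContDiff ℝ 1 fun p : ℝ × V3 => pxS j (P3 p.1) p.2 :=
  contDiff_pi.1 hgradP3 j

lemma wc_g_pt0
    (hP3hom : ∀ t : ℝ, ∀ ζ > (0 : ℝ), ∀ y : V3, P3 t (ζ • y) = ζ ^ 3 * P3 t y)
    (hP3diff : Differentiable ℝ fun p : ℝ × V3 => P3 p.1 p.2)
    (hgradP3 : ContDiff ℝ 1 fun p : ℝ × V3 => (fun j => pxS j (P3 p.1) p.2))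
    (t : ℝ) (j : Fin 3) :
    ptD (fun p : ℝ × V3 => pxS j (P3 p.1) p.2) (t, 0) = 0 := by
  refine wc_ptD_line ((wc_g_contDiff hgradP3 j).differentiable (by norm_num) _) ?_
  simp only [wc_g_zero hP3hom hP3diff]
  exact hasDerivAt_const _ _

lemma wc_g_px0
    (hP3hom : ∀ t : ℝ, ∀ ζ > (0 : ℝ), ∀ y : V3, P3 t (ζ • y) = ζ ^ 3 * P3 t y)
    (hP3diff : Differentiable ℝ fun p : ℝ × V3 => P3 p.1 p.2)
    (hgradP3 : ContDiff ℝ 1 fun p : ℝ × V3 => (fun j => pxS j (P3 p.1) p.2))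
    (t : ℝ) (i j : Fin 3) :
    pxD i (fun p : ℝ × V3 => pxS j (P3 p.1) p.2) (t, 0) = 0 := by
  have h := wc_pxD_hasDerivAt (y := 0) (t := t) i
    ((wc_g_contDiff hgradP3 j).differentiable (by norm_num) _)
  have h1 := h.hasDerivWithinAt (s := Set.Ici 0)
  have h2 : HasDerivWithinAt (fun s : ℝ => s ^ 2 * pxS j (P3 t) (EuclideanSpace.single i (1 : ℝ)))
      0 (Set.Ici 0) 0 := by
    have := ((hasDerivAt_pow 2 (0 : ℝ)).mul_const
      (pxS j (P3 t) (EuclideanSpace.single i (1 : ℝ)))).hasDerivWithinAt (s := Set.Ici 0)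
    simpa using this
  have h3 : ∀ s ∈ Set.Ici (0 : ℝ), pxS j (P3 t) (0 + s • EuclideanSpace.single i (1 : ℝ))
      = s ^ 2 * pxS j (P3 t) (EuclideanSpace.single i (1 : ℝ)) := by
    intro s hs
    rcases (show (0 : ℝ) ≤ s from hs).eq_or_lt with h0 | h0
    · subst h0
      simp [wc_g_zero hP3hom hP3diff]
    · rw [zero_add]
      exact wc_g_hom hP3hom hP3diff t _ j s h0
  have h4 := h2.congr h3 (h3 0 (by simp))
  exact (uniqueDiffWithinAt_Ici (0 : ℝ)).eq_deriv _ h1 h4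

lemma wc_P3_pt
    (hP3hom : ∀ t : ℝ, ∀ ζ > (0 : ℝ), ∀ y : V3, P3 t (ζ • y) = ζ ^ 3 * P3 t y)
    (hP3diff : Differentiable ℝ fun p : ℝ × V3 => P3 p.1 p.2)
    (hgradP3 : ContDiff ℝ 1 fun p : ℝ × V3 => (fun j => pxS j (P3 p.1) p.2))
    (t : ℝ) (y : V3) :
    ptD (fun p : ℝ × V3 => P3 p.1 p.2) (t, y)
      = ∑ j, y j * ((1 / 3) * ptD (fun p : ℝ × V3 => pxS j (P3 p.1) p.2) (t, y)) := by
  refine wc_ptD_line (hP3diff _) ?_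
  have h : (fun s => P3 s y) = fun s => ∑ j, y j * ((1 / 3) * pxS j (P3 s) y) := by
    funext s
    have := wc_P3_euler hP3hom hP3diff s y
    rw [Fin.sum_univ_three] at this ⊢
    linarith
  show HasDerivAt (fun s => P3 s y) _ t
  rw [h]
  refine HasDerivAt.fun_sum fun j _ => HasDerivAt.const_mul _ (HasDerivAt.const_mul _ ?_)
  exact wc_ptD_hasDerivAt (f := fun p : ℝ × V3 => pxS j (P3 p.1) p.2)
    ((wc_g_contDiff hgradP3 j).differentiable (by norm_num) _)

end P3facts

lemma wc_d2 (f : ℝ → Fin 3 → Fin 3 → ℝ) (hf : Differentiable ℝ f) (j i : Fin 3) :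
    Differentiable ℝ (fun s => f s j i) := by fun_prop

lemma wc_snd_diff (i : Fin 3) : Differentiable ℝ (fun p : ℝ × V3 => p.2 i) := by fun_prop

/-- The magnetic potential in the moving frame. -/
def wcAJ (A0 : ℝ → Fin 3 → ℝ) (A1 : ℝ → Fin 3 → Fin 3 → ℝ) (P3 : ℝ → V3 → ℝ) (j : Fin 3)
    (p : ℝ × V3) : ℝ :=
  A0 p.1 j + ∑ i, A1 p.1 j i * p.2 i + pxS j (P3 p.1) p.2

lemma wcAJ_diff {A0 : ℝ → Fin 3 → ℝ} {A1 : ℝ → Fin 3 → Fin 3 → ℝ} {P3 : ℝ → V3 → ℝ}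
    (hA0 : Differentiable ℝ A0) (hA1 : Differentiable ℝ A1)
    (hgradP3 : ContDiff ℝ 1 fun p : ℝ × V3 => (fun j => pxS j (P3 p.1) p.2)) (j : Fin 3) :
    Differentiable ℝ (wcAJ A0 A1 P3 j) := by
  have h := (wc_g_contDiff hgradP3 j).differentiable (by norm_num)
  unfold wcAJ
  refine Differentiable.add ?_ h
  fun_prop

lemma wc_A_eq (r : ℝ → V3) (A0 : ℝ → Fin 3 → ℝ) (A1 : ℝ → Fin 3 → Fin 3 → ℝ)
    (P3 : ℝ → V3 → ℝ) :
    AWC r A0 A1 P3 = fun p j => wcAJ A0 A1 P3 j (p.1, p.2 - r p.1) := rfl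

lemma wc_A_fields {r : ℝ → V3} {A0 : ℝ → Fin 3 → ℝ} {A1 : ℝ → Fin 3 → Fin 3 → ℝ}
    {P3 : ℝ → V3 → ℝ} (hr : Differentiable ℝ r)
    (hA0 : Differentiable ℝ A0) (hA1 : Differentiable ℝ A1)
    (hP3hom : ∀ t : ℝ, ∀ ζ > (0 : ℝ), ∀ y : V3, P3 t (ζ • y) = ζ ^ 3 * P3 t y)
    (hP3diff : Differentiable ℝ fun p : ℝ × V3 => P3 p.1 p.2)
    (hgradP3 : ContDiff ℝ 1 fun p : ℝ × V3 => (fun j => pxS j (P3 p.1) p.2)) (t : ℝ) (j : Fin 3) :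
    ptD (AWC r A0 A1 P3) (t, r t) j
      = deriv (fun s => A0 s j) t - ∑ i, deriv r t i * A1 t j i ∧
    ∀ i, pxD i (AWC r A0 A1 P3) (t, r t) j = A1 t j i := by
  have hJ := fun j => wcAJ_diff hA0 hA1 hgradP3 j
  have hch := fun j => wc_chain (t := t) (x := r t) (hr t) (hJ j (t, r t - r t))
  have hg := (wc_g_contDiff hgradP3 j).differentiable (by norm_num)
  have hpi : fderiv ℝ (AWC r A0 A1 P3) (t, r t) = _ :=
    (hasFDerivAt_pi.2 fun j => (hch j).1.hasFDerivAt).fderiv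
  have hA0' : HasDerivAt (fun s => A0 s j) (deriv (fun s => A0 s j) t) t :=
    DifferentiableAt.hasDerivAt (by fun_prop)
  have hx : ∀ i, pxD i (wcAJ A0 A1 P3 j) (t, 0) = A1 t j i := by
    intro i
    refine wc_pxD_line i (hJ j _) ?_
    have h1 := wc_pxD_hasDerivAt i (hg (t, 0))
    rw [wc_g_px0 hP3hom hP3diff hgradP3] at h1
    have h2 : HasDerivAt (fun s : ℝ => ∑ k, A1 t j k * (0 + s • EuclideanSpace.single i (1 : ℝ) : V3) k)
        (∑ k, A1 t j k * (if k = i then 1 else 0)) 0 :=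
      HasDerivAt.fun_sum fun k _ => (wc_coord i k 0).const_mul _
    have h3 := ((hasDerivAt_const (0 : ℝ) (A0 t j)).add h2).add h1
    exact h3.congr_deriv (by simp)
  have ht : ptD (wcAJ A0 A1 P3 j) (t, 0) = deriv (fun s => A0 s j) t := by
    refine wc_ptD_line (hJ j _) ?_
    have h1 := wc_ptD_hasDerivAt (hg (t, 0))
    rw [wc_g_pt0 hP3hom hP3diff hgradP3] at h1
    have h3 := hA0'.add h1
    have e : (fun s => wcAJ A0 A1 P3 j (s, 0)) = fun s => A0 s j + pxS j (P3 s) 0 := by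
      funext s
      simp [wcAJ]
    rw [e]
    exact h3.congr_deriv (by simp)
  constructor
  · have := (hch j).2.1
    simp only [sub_self, ht, hx, smul_eq_mul] at this
    rw [← this]
    unfold ptD
    rw [hpi]
    rfl
  · intro i
    have := (hch j).2.2 i
    simp only [sub_self, hx] at this
    rw [← this]
    unfold pxD
    rw [hpi]
    rfl

/-- `∂_t (P₂ + P₃)`. -/
lemma wc_P23 {A1 : ℝ → Fin 3 → Fin 3 → ℝ}
    {P3 : ℝ → V3 → ℝ} (hA1 : Differentiable ℝ A1)
    (hP3hom : ∀ t : ℝ, ∀ ζ > (0 : ℝ), ∀ y : V3, P3 t (ζ • y) = ζ ^ 3 * P3 t y)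
    (hP3diff : Differentiable ℝ fun p : ℝ × V3 => P3 p.1 p.2)
    (hgradP3 : ContDiff ℝ 1 fun p : ℝ × V3 => (fun j => pxS j (P3 p.1) p.2)) (t : ℝ) (y : V3) :
    HasDerivAt (fun s => P2q A1 s (fun i => y i) + P3 s y)
      (∑ j, y j * ((1 / 2) * (∑ i, deriv (fun s => A1 s j i) t * y i)
        + (1 / 3) * ptD (fun p : ℝ × V3 => pxS j (P3 p.1) p.2) (t, y))) t := by
  have h1 := wc_ptD_hasDerivAt (hP3diff (t, y))
  rw [wc_P3_pt hP3hom hP3diff hgradP3] at h1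
  have hA : ∀ j i, HasDerivAt (fun s => A1 s j i) (deriv (fun s => A1 s j i) t) t :=
    fun j i => DifferentiableAt.hasDerivAt (by fun_prop)
  have h2 : HasDerivAt (fun s => P2q A1 s (fun i => y i))
      ((1 / 2) * ∑ j, y j * ∑ i, deriv (fun s => A1 s j i) t * y i) t := by
    refine HasDerivAt.const_mul _ (HasDerivAt.fun_sum fun j _ => HasDerivAt.const_mul _ ?_)
    exact HasDerivAt.fun_sum fun i _ => (hA j i).mul_const _
  refine HasDerivAt.congr_deriv (h2.add h1) ?_
  simp only [Fin.sum_univ_three]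
  ring

/-- The electric potential in the moving frame. -/
def wcPhiJ (m q c : ℝ) (r : ℝ → V3) (φ0 : ℝ → ℝ) (φ1 : ℝ → Fin 3 → ℝ)
    (A1 : ℝ → Fin 3 → Fin 3 → ℝ) (P3 : ℝ → V3 → ℝ) (p : ℝ × V3) : ℝ :=
  φ0 p.1 + dot3 (fun i => p.2 i) (φ1 p.1) + phi2WC m q c r A1 P3 p.1 p.2

lemma wc_phi_eq (m q c : ℝ) (r : ℝ → V3) (φ0 : ℝ → ℝ) (φ1 : ℝ → Fin 3 → ℝ)
    (A1 : ℝ → Fin 3 → Fin 3 → ℝ) (P3 : ℝ → V3 → ℝ) :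
    phiWC m q c r φ0 φ1 A1 P3 = fun p => wcPhiJ m q c r φ0 φ1 A1 P3 (p.1, p.2 - r p.1) := rfl

lemma wc_flat_g {P3 : ℝ → V3 → ℝ}
    (hP3hom : ∀ t : ℝ, ∀ ζ > (0 : ℝ), ∀ y : V3, P3 t (ζ • y) = ζ ^ 3 * P3 t y)
    (hP3diff : Differentiable ℝ fun p : ℝ × V3 => P3 p.1 p.2)
    (hgradP3 : ContDiff ℝ 1 fun p : ℝ × V3 => (fun j => pxS j (P3 p.1) p.2)) (t : ℝ) (j : Fin 3) :
    HasFDerivAt (fun p : ℝ × V3 => pxS j (P3 p.1) p.2) (0 : ℝ × V3 →L[ℝ] ℝ) (t, 0) := by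
  have hg := (wc_g_contDiff hgradP3 j).differentiable (by norm_num) (t, 0)
  refine hg.hasFDerivAt.congr_fderiv ?_
  refine ContinuousLinearMap.ext fun z => ?_
  obtain ⟨s, w⟩ := z
  have ez : ((s, w) : ℝ × V3) = s • ((1 : ℝ), (0 : V3)) + ((0 : ℝ), w) := by simp
  have hw : fderiv ℝ (fun p : ℝ × V3 => pxS j (P3 p.1) p.2) (t, 0) (0, w) = 0 := by
    have h0 := fun i => wc_g_px0 hP3hom hP3diff hgradP3 t i j
    unfold pxD at h0
    have e2 := wc_fderiv_sum ((fderiv ℝ (fun p : ℝ × V3 => pxS j (P3 p.1) p.2) (t, 0)).comp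
      (ContinuousLinearMap.inr ℝ ℝ V3)) w
    simp only [ContinuousLinearMap.comp_apply, ContinuousLinearMap.inr_apply, h0] at e2
    simpa using e2
  have ht := wc_g_pt0 hP3hom hP3diff hgradP3 t j
  unfold ptD at ht
  rw [ez, map_add, map_smul, hw, ht]
  simp

lemma wc_phi_field {m q c : ℝ} {r : ℝ → V3} {φ0 : ℝ → ℝ} {φ1 : ℝ → Fin 3 → ℝ}
    {A1 : ℝ → Fin 3 → Fin 3 → ℝ}
    {P3 : ℝ → V3 → ℝ} (hr : Differentiable ℝ r) (hv : Differentiable ℝ (deriv r))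
    (hφ0 : Differentiable ℝ φ0) (hφ1 : Differentiable ℝ φ1)
    (hA1 : ContDiff ℝ 1 A1)
    (hP3hom : ∀ t : ℝ, ∀ ζ > (0 : ℝ), ∀ y : V3, P3 t (ζ • y) = ζ ^ 3 * P3 t y)
    (hP3diff : Differentiable ℝ fun p : ℝ × V3 => P3 p.1 p.2)
    (hgradP3 : ContDiff ℝ 1 fun p : ℝ × V3 => (fun j => pxS j (P3 p.1) p.2)) (t : ℝ) (i : Fin 3) :
    pxD i (phiWC m q c r φ0 φ1 A1 P3) (t, r t) = φ1 t i := by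
  have hA1d : Differentiable ℝ A1 := hA1.differentiable (by norm_num)
  have hy : ∀ j, DifferentiableAt ℝ (fun p : ℝ × V3 => p.2 j) (t, 0) :=
    fun j => wc_snd_diff j _
  -- first: the square of the rotational part
  have hB : ∀ j, DifferentiableAt ℝ (fun p : ℝ × V3 => breveA A1 p.1 (fun i => p.2 i) j) (t, 0) := by
    intro j
    unfold breveA
    fun_prop
  have hB0 : ∀ j, breveA A1 t (fun i => (0 : V3) i) j = 0 := by
    intro j
    simp [breveA]
  have hBB : HasFDerivAt (fun p : ℝ × V3 => ∑ j, breveA A1 p.1 (fun i => p.2 i) j ^ 2)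
      (0 : ℝ × V3 →L[ℝ] ℝ) (t, 0) := by
    have : HasFDerivAt (fun p : ℝ × V3 => ∑ j, breveA A1 p.1 (fun i => p.2 i) j
        * breveA A1 p.1 (fun i => p.2 i) j) (∑ j : Fin 3, (0 : ℝ × V3 →L[ℝ] ℝ)) (t, 0) :=
      HasFDerivAt.fun_sum fun j _ => wc_mul_flat (hB j) (hB0 j) (hB j).continuousAt (hB0 j)
    simpa [sq] using this
  -- second: the time derivative
  have hA' : ∀ j k, Continuous (deriv (fun s => A1 s j k)) := by
    intro j k
    have : ContDiff ℝ 1 (fun s => A1 s j k) := contDiff_pi.1 (contDiff_pi.1 hA1 j) k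
    exact this.continuous_deriv (by norm_num)
  have hg' : ∀ j, Continuous (ptD (fun p : ℝ × V3 => pxS j (P3 p.1) p.2)) := by
    intro j
    exact ((wc_g_contDiff hgradP3 j).continuous_fderiv (by norm_num)).clm_apply continuous_const
  have hT : HasFDerivAt (fun p : ℝ × V3 => deriv (fun s => P2q A1 s (fun i => p.2 i) + P3 s p.2) p.1)
      (0 : ℝ × V3 →L[ℝ] ℝ) (t, 0) := by
    have e : (fun p : ℝ × V3 => deriv (fun s => P2q A1 s (fun i => p.2 i) + P3 s p.2) p.1)
      = fun p : ℝ × V3 => ∑ j, p.2 j * ((1 / 2) * (∑ i, deriv (fun s => A1 s j i) p.1 * p.2 i)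
        + (1 / 3) * ptD (fun p : ℝ × V3 => pxS j (P3 p.1) p.2) p) := by
      funext p
      exact (wc_P23 hA1d hP3hom hP3diff hgradP3 p.1 p.2).deriv
    rw [e]
    have : HasFDerivAt (fun p : ℝ × V3 => ∑ j, p.2 j *
        ((1 / 2) * (∑ i, deriv (fun s => A1 s j i) p.1 * p.2 i)
        + (1 / 3) * ptD (fun p : ℝ × V3 => pxS j (P3 p.1) p.2) p))
        (∑ j : Fin 3, (0 : ℝ × V3 →L[ℝ] ℝ)) (t, 0) := by
      refine HasFDerivAt.fun_sum fun j _ => wc_mul_flat (hy j) (by simp) ?_ ?_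
      · apply Continuous.continuousAt
        refine Continuous.add (continuous_const.mul (continuous_finsetSum _ fun k _ => ?_))
          (continuous_const.mul (hg' j))
        exact ((hA' j k).comp continuous_fst).mul (wc_snd_diff k).continuous
      · simp [wc_g_pt0 hP3hom hP3diff hgradP3]
    simpa using this
  -- third
  have hV : HasFDerivAt (fun p : ℝ × V3 => dot3 (fun i => deriv r p.1 i)
      (fun j => pxS j (P3 p.1) p.2)) (0 : ℝ × V3 →L[ℝ] ℝ) (t, 0) := by
    have : HasFDerivAt (fun p : ℝ × V3 => ∑ j, deriv r p.1 j * pxS j (P3 p.1) p.2)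
        (∑ j : Fin 3, (0 : ℝ × V3 →L[ℝ] ℝ)) (t, 0) := by
      refine HasFDerivAt.fun_sum fun j _ => ?_
      have h1 : DifferentiableAt ℝ (fun p : ℝ × V3 => deriv r p.1 j) (t, 0) := by fun_prop
      have h2 := h1.hasFDerivAt.mul (wc_flat_g hP3hom hP3diff hgradP3 t j)
      exact h2.congr_fderiv (by simp [wc_g_zero hP3hom hP3diff])
    simpa [dot3] using this
  have h2 : HasFDerivAt (fun p : ℝ × V3 => phi2WC m q c r A1 P3 p.1 p.2)
      (0 : ℝ × V3 →L[ℝ] ℝ) (t, 0) := by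
    have := ((hBB.const_mul (-(q / (2 * m * c ^ 2)))).sub (hT.const_mul (1 / c))).add
      (hV.const_mul (1 / c))
    simp only [smul_zero, sub_zero, add_zero] at this
    exact this
  have hd1 : DifferentiableAt ℝ (fun p : ℝ × V3 => φ0 p.1 + dot3 (fun i => p.2 i) (φ1 p.1)) (t, 0) := by
    unfold dot3
    fun_prop
  have hd : DifferentiableAt ℝ (wcPhiJ m q c r φ0 φ1 A1 P3) (t, 0) :=
    hd1.add h2.differentiableAt
  rw [wc_phi_eq, (wc_chain (hr t) (by simpa using hd)).2.2 i, sub_self]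
  have h3 : pxD i (wcPhiJ m q c r φ0 φ1 A1 P3) (t, 0)
      = pxD i (fun p : ℝ × V3 => φ0 p.1 + dot3 (fun i => p.2 i) (φ1 p.1)) (t, 0) := by
    have := (hd1.hasFDerivAt.add h2).fderiv
    rw [add_zero] at this
    exact congrArg (fun L => L (0, EuclideanSpace.single i 1)) this
  rw [h3]
  refine wc_pxD_line i hd1 ?_
  have h4 : HasDerivAt (fun s : ℝ => ∑ k, (0 + s • EuclideanSpace.single i (1 : ℝ) : V3) k * φ1 t k)
      (∑ k, (if k = i then 1 else 0) * φ1 t k) 0 :=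
    HasDerivAt.fun_sum fun k _ => (wc_coord i k 0).mul_const _
  have h5 := h4.const_add (φ0 t)
  exact h5.congr_deriv (by simp)

/-- Rotational velocity-like field `W = ∇S − (q/(χc)) A`. -/
def wcW (χ m q c : ℝ) (r : ℝ → V3) (A1 : ℝ → Fin 3 → Fin 3 → ℝ) (i : Fin 3) (p : ℝ × V3) : ℝ :=
  (m / χ) * deriv r p.1 i - (q / (χ * c)) * breveA A1 p.1 (fun k => p.2 k) i

lemma wc_coord_deriv {f : ℝ → V3} {f' : V3} {t : ℝ} (h : HasDerivAt f f' t) (i : Fin 3) :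
    HasDerivAt (fun s => f s i) (f' i) t :=
  (EuclideanSpace.proj (𝕜 := ℝ) i).hasFDerivAt.comp_hasDerivAt t h

section Phase

variable {χ m q c : ℝ} {r : ℝ → V3} {φ0 : ℝ → ℝ} {A0 : ℝ → Fin 3 → ℝ}
  {A1 : ℝ → Fin 3 → Fin 3 → ℝ} {P3 : ℝ → V3 → ℝ}

lemma wc_sp_deriv (hv : Continuous (deriv r)) (hφ0 : Continuous φ0) (hA0 : Continuous A0) (t : ℝ) :
    HasDerivAt (spWC χ m q c r φ0 A0) (χ⁻¹ * ((1 / 2) * m * (∑ i, (deriv r t i) ^ 2)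
      + (q / c) * dot3 (fun i => deriv r t i) (A0 t) - q * φ0 t)) t := by
  have hc : Continuous (fun t' => (1 / 2) * m * (∑ i, (deriv r t' i) ^ 2)
      + (q / c) * dot3 (fun i => deriv r t' i) (A0 t') - q * φ0 t') := by
    unfold dot3
    fun_prop
  exact (hc.integral_hasStrictDerivAt 0 t).hasDerivAt.const_mul _

lemma wc_S_eq (hχ : 0 < χ) (hc : 0 < c)
    (hP3hom : ∀ t : ℝ, ∀ ζ > (0 : ℝ), ∀ y : V3, P3 t (ζ • y) = ζ ^ 3 * P3 t y)
    (hP3diff : Differentiable ℝ fun p : ℝ × V3 => P3 p.1 p.2) (t : ℝ) (y : V3) :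
    SWC χ m q c r φ0 A0 A1 P3 t y = (m / χ) * (∑ i, deriv r t i * y i)
      + (q / (χ * c)) * (∑ i, y i * A0 t i) + spWC χ m q c r φ0 A0 t
      + (q / (χ * c)) * (P2q A1 t (fun i => y i) + P3 t y) := by
  have := wc_P3_euler hP3hom hP3diff t y
  unfold SWC sp2WC P2q
  have e : dot3 (fun i => y i) (fun j => pxS j (P3 t) y) = 3 * P3 t y := this
  rw [e]
  have h1 := hχ.ne'
  have h2 := hc.ne'
  simp only [dot3]
  field_simp

lemma wc_S_deriv (hχ : 0 < χ) (hc : 0 < c)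
    (hv : Differentiable ℝ (deriv r)) (hφ0 : Continuous φ0) (hA0 : Differentiable ℝ A0)
    (hA1 : Differentiable ℝ A1)
    (hP3hom : ∀ t : ℝ, ∀ ζ > (0 : ℝ), ∀ y : V3, P3 t (ζ • y) = ζ ^ 3 * P3 t y)
    (hP3diff : Differentiable ℝ fun p : ℝ × V3 => P3 p.1 p.2)
    (hgradP3 : ContDiff ℝ 1 fun p : ℝ × V3 => (fun j => pxS j (P3 p.1) p.2)) :
    Differentiable ℝ (fun p : ℝ × V3 => SWC χ m q c r φ0 A0 A1 P3 p.1 p.2) ∧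
    (∀ t y, ptD (fun p : ℝ × V3 => SWC χ m q c r φ0 A0 A1 P3 p.1 p.2) (t, y)
      = (m / χ) * (∑ i, deriv (deriv r) t i * y i)
      + (q / (χ * c)) * (∑ i, y i * deriv (fun s => A0 s i) t)
      + χ⁻¹ * ((1 / 2) * m * (∑ i, (deriv r t i) ^ 2)
        + (q / c) * dot3 (fun i => deriv r t i) (A0 t) - q * φ0 t)
      + (q / (χ * c)) * deriv (fun s => P2q A1 s (fun i => y i) + P3 s y) t) ∧
    (∀ t y i, pxD i (fun p : ℝ × V3 => SWC χ m q c r φ0 A0 A1 P3 p.1 p.2) (t, y)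
      = (m / χ) * deriv r t i + (q / (χ * c)) * A0 t i
        + (q / (χ * c)) * ((1 / 2) * (∑ k, (A1 t i k + A1 t k i) * y k) + pxS i (P3 t) y)) := by
  have e : (fun p : ℝ × V3 => SWC χ m q c r φ0 A0 A1 P3 p.1 p.2) = fun p : ℝ × V3 =>
      (m / χ) * (∑ i, deriv r p.1 i * p.2 i)
      + (q / (χ * c)) * (∑ i, p.2 i * A0 p.1 i) + spWC χ m q c r φ0 A0 p.1
      + (q / (χ * c)) * (P2q A1 p.1 (fun i => p.2 i) + P3 p.1 p.2) := by
    funext p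
    exact wc_S_eq hχ hc hP3hom hP3diff p.1 p.2
  have hsp := wc_sp_deriv (χ := χ) (m := m) (q := q) (c := c) hv.continuous hφ0 hA0.continuous
  have hspd : Differentiable ℝ (spWC χ m q c r φ0 A0) := fun t => (hsp t).differentiableAt
  have hP2 : Differentiable ℝ (fun p : ℝ × V3 => P2q A1 p.1 (fun i => p.2 i)) := by
    unfold P2q dot3 matVec
    fun_prop
  have hd : Differentiable ℝ (fun p : ℝ × V3 => SWC χ m q c r φ0 A0 A1 P3 p.1 p.2) := by
    rw [e]
    refine Differentiable.add (Differentiable.add ?_ (hspd.comp differentiable_fst))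
      ((hP2.add hP3diff).const_mul _)
    fun_prop
  refine ⟨hd, fun t y => ?_, fun t y i => ?_⟩
  · refine wc_ptD_line (hd _) ?_
    have h0 := congrArg (fun F : ℝ × V3 → ℝ => fun s => F (s, y)) e
    simp only at h0
    rw [h0]
    have hA : ∀ j, HasDerivAt (fun s => A0 s j) (deriv (fun s => A0 s j) t) t :=
      fun j => DifferentiableAt.hasDerivAt (by fun_prop)
    have h1 : HasDerivAt (fun s => ∑ i, deriv r s i * y i) (∑ i, deriv (deriv r) t i * y i) t :=
      HasDerivAt.fun_sum fun i _ => (wc_coord_deriv (hv t).hasDerivAt i).mul_const _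
    have h2 : HasDerivAt (fun s => ∑ i, y i * A0 s i) (∑ i, y i * deriv (fun s => A0 s i) t) t :=
      HasDerivAt.fun_sum fun i _ => (hA i).const_mul _
    have h3 := (wc_P23 hA1 hP3hom hP3diff hgradP3 t y).differentiableAt.hasDerivAt
    exact (((h1.const_mul (m / χ)).add (h2.const_mul (q / (χ * c)))).add (hsp t)).add
      (h3.const_mul (q / (χ * c)))
  · refine wc_pxD_line i (hd _) ?_
    have h0 := congrArg (fun F : ℝ × V3 → ℝ =>
      fun s : ℝ => F (t, y + s • EuclideanSpace.single i (1 : ℝ))) e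
    simp only at h0
    rw [h0]
    have h1 : HasDerivAt (fun s : ℝ => ∑ k, deriv r t k *
        (y + s • EuclideanSpace.single i (1 : ℝ) : V3) k)
        (∑ k, deriv r t k * (if k = i then 1 else 0)) 0 :=
      HasDerivAt.fun_sum fun k _ => (wc_coord i k y).const_mul _
    have h2 : HasDerivAt (fun s : ℝ => ∑ k,
        (y + s • EuclideanSpace.single i (1 : ℝ) : V3) k * A0 t k)
        (∑ k, (if k = i then 1 else 0) * A0 t k) 0 :=
      HasDerivAt.fun_sum fun k _ => (wc_coord i k y).mul_const _
    have h3 : HasDerivAt (fun s : ℝ => P2q A1 t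
        (fun k => (y + s • EuclideanSpace.single i (1 : ℝ) : V3) k))
        ((1 / 2) * ∑ j, ((if j = i then 1 else 0) * (∑ k, A1 t j k * y k)
          + y j * ∑ k, A1 t j k * (if k = i then 1 else 0))) 0 := by
      have hin : ∀ j, HasDerivAt (fun s : ℝ => ∑ k, A1 t j k *
        (y + s • EuclideanSpace.single i (1 : ℝ) : V3) k)
        (∑ k, A1 t j k * (if k = i then 1 else 0)) 0 := fun j =>
        HasDerivAt.fun_sum fun k _ => (wc_coord i k y).const_mul _
      refine HasDerivAt.const_mul _ (HasDerivAt.fun_sum fun j _ => ?_)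
      have := (wc_coord i j y).mul (hin j)
      exact this.congr_deriv (by simp)
    have h4 : HasDerivAt (fun s : ℝ => P3 t (y + s • EuclideanSpace.single i (1 : ℝ)))
        (pxS i (P3 t) y) 0 := wc_pxS_hasDerivAt i (wc_P3_diff hP3diff t y)
    have h5 := (((h1.const_mul (m / χ)).add (h2.const_mul (q / (χ * c)))).add_const
      (spWC χ m q c r φ0 A0 t)).add ((h3.add h4).const_mul (q / (χ * c)))
    refine HasDerivAt.congr_deriv h5 ?_
    simp only [ite_mul, mul_ite, one_mul, zero_mul, mul_one, mul_zero, Finset.sum_add_distrib,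
      Finset.sum_ite_eq', Finset.mem_univ, if_true]
    simp only [Fin.sum_univ_three]
    ring

lemma wc_newton {φ1 : ℝ → Fin 3 → ℝ} (hr : Differentiable ℝ r) (hv : Differentiable ℝ (deriv r))
    (hφ0 : Differentiable ℝ φ0) (hφ1 : Differentiable ℝ φ1) (hA0 : Differentiable ℝ A0)
    (hA1 : ContDiff ℝ 1 A1)
    (hP3hom : ∀ t : ℝ, ∀ ζ > (0 : ℝ), ∀ y : V3, P3 t (ζ • y) = ζ ^ 3 * P3 t y)
    (hP3diff : Differentiable ℝ fun p : ℝ × V3 => P3 p.1 p.2)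
    (hgradP3 : ContDiff ℝ 1 fun p : ℝ × V3 => (fun j => pxS j (P3 p.1) p.2))
    (hNewton : ∀ t : ℝ, ∀ j : Fin 3,
      m * deriv (deriv r) t j
        = q * ED c (phiWC m q c r φ0 φ1 A1 P3) (AWC r A0 A1 P3) (t, r t) j
          + (q / c) * cross3 (fun i => deriv r t i)
              (BD (AWC r A0 A1 P3) (t, r t)) j) (t : ℝ) (j : Fin 3) :
    m * deriv (deriv r) t j = - q * φ1 t j - (q / c) * deriv (fun s => A0 s j) t
      + (q / c) * ∑ i, A1 t i j * deriv r t i := by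
  rw [hNewton]
  have hA1d : Differentiable ℝ A1 := hA1.differentiable (by norm_num)
  have h1 := fun j => (wc_A_fields hr hA0 hA1d hP3hom hP3diff hgradP3 t j).1
  have h2 := fun j => (wc_A_fields hr hA0 hA1d hP3hom hP3diff hgradP3 t j).2
  have h3 := fun i => wc_phi_field (m := m) (q := q) (c := c) hr hv hφ0 hφ1 hA1 hP3hom hP3diff hgradP3 t i
  simp only [ED, cross3, BD, h1, h2, h3]
  fin_cases j <;> simp [Fin.sum_univ_three] <;> ring

lemma wc_W_eq (hχ : 0 < χ) (hc : 0 < c)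
    (hv : Differentiable ℝ (deriv r)) (hφ0 : Continuous φ0) (hA0 : Differentiable ℝ A0)
    (hA1 : Differentiable ℝ A1)
    (hP3hom : ∀ t : ℝ, ∀ ζ > (0 : ℝ), ∀ y : V3, P3 t (ζ • y) = ζ ^ 3 * P3 t y)
    (hP3diff : Differentiable ℝ fun p : ℝ × V3 => P3 p.1 p.2)
    (hgradP3 : ContDiff ℝ 1 fun p : ℝ × V3 => (fun j => pxS j (P3 p.1) p.2))
    (p : ℝ × V3) (i : Fin 3) :
    pxD i (fun p : ℝ × V3 => SWC χ m q c r φ0 A0 A1 P3 p.1 p.2) p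
      - q / (χ * c) * wcAJ A0 A1 P3 i p = wcW χ m q c r A1 i p := by
  obtain ⟨t, y⟩ := p
  rw [(wc_S_deriv hχ hc hv hφ0 hA0 hA1 hP3hom hP3diff hgradP3).2.2]
  simp only [wcAJ, wcW, breveA, Fin.sum_univ_three]
  ring

/-- The real (Hamilton–Jacobi) part of the equation. -/
lemma wc_HJ {φ1 : ℝ → Fin 3 → ℝ} (hχ : 0 < χ) (hm : 0 < m) (hc : 0 < c)
    (hr : Differentiable ℝ r) (hv : Differentiable ℝ (deriv r))
    (hφ0 : Differentiable ℝ φ0) (hφ1 : Differentiable ℝ φ1) (hA0 : Differentiable ℝ A0)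
    (hA1 : ContDiff ℝ 1 A1)
    (hP3hom : ∀ t : ℝ, ∀ ζ > (0 : ℝ), ∀ y : V3, P3 t (ζ • y) = ζ ^ 3 * P3 t y)
    (hP3diff : Differentiable ℝ fun p : ℝ × V3 => P3 p.1 p.2)
    (hgradP3 : ContDiff ℝ 1 fun p : ℝ × V3 => (fun j => pxS j (P3 p.1) p.2))
    (hNewton : ∀ t : ℝ, ∀ j : Fin 3,
      m * deriv (deriv r) t j
        = q * ED c (phiWC m q c r φ0 φ1 A1 P3) (AWC r A0 A1 P3) (t, r t) j
          + (q / c) * cross3 (fun i => deriv r t i)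
              (BD (AWC r A0 A1 P3) (t, r t)) j) (t : ℝ) (y : V3) :
    -(ptD (fun p : ℝ × V3 => SWC χ m q c r φ0 A0 A1 P3 p.1 p.2) (t, y)
      - ∑ i, deriv r t i * pxD i (fun p : ℝ × V3 => SWC χ m q c r φ0 A0 A1 P3 p.1 p.2) (t, y))
      - (q / χ) * wcPhiJ m q c r φ0 φ1 A1 P3 (t, y)
      = (χ / (2 * m)) * ∑ i, wcW χ m q c r A1 i (t, y) ^ 2 := by
  have hA1d : Differentiable ℝ A1 := hA1.differentiable (by norm_num)
  obtain ⟨-, hSt, hSx⟩ := wc_S_deriv (m := m) (q := q) hχ hc hv hφ0.continuous hA0 hA1d hP3hom hP3diff hgradP3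
  have hN := wc_newton hr hv hφ0 hφ1 hA0 hA1 hP3hom hP3diff hgradP3 hNewton t
  have hN' : ∀ j, deriv (deriv r) t j = m⁻¹ * (- q * φ1 t j - (q / c) * deriv (fun s => A0 s j) t
      + (q / c) * ∑ i, A1 t i j * deriv r t i) := by
    intro j
    rw [← hN j]
    field_simp
  simp only [hSt, hSx, hN', wcPhiJ, phi2WC, wcW, breveA, dot3, Fin.sum_univ_three]
  have h1 := hχ.ne'
  have h2 := hc.ne'
  have h3 := hm.ne'
  field_simp
  ring

end Phase

lemma wc_f_lift {f : V3 → ℝ} (hf : Differentiable ℝ f) (p : ℝ × V3) :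
    DifferentiableAt ℝ (fun z : ℝ × V3 => ((f z.2 : ℝ) : ℂ)) p ∧
    ptD (fun z : ℝ × V3 => ((f z.2 : ℝ) : ℂ)) p = 0 ∧
    ∀ i, pxD i (fun z : ℝ × V3 => ((f z.2 : ℝ) : ℂ)) p = ((pxS i f p.2 : ℝ) : ℂ) := by
  have h1 : HasFDerivAt (fun z : ℝ × V3 => f z.2)
      ((fderiv ℝ f p.2).comp (ContinuousLinearMap.snd ℝ ℝ V3)) p :=
    HasFDerivAt.comp p (hf p.2).hasFDerivAt hasFDerivAt_snd
  have h2 : HasFDerivAt (fun z : ℝ × V3 => ((f z.2 : ℝ) : ℂ)) _ p :=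
    Complex.ofRealCLM.hasFDerivAt.comp p h1
  refine ⟨h2.differentiableAt, ?_, fun i => ?_⟩
  · unfold ptD
    rw [h2.fderiv]
    simp
  · unfold pxD pxS
    rw [h2.fderiv]
    simp

lemma wc_W_px {χ m q c : ℝ} {r : ℝ → V3} (hv : Differentiable ℝ (deriv r))
    {A1 : ℝ → Fin 3 → Fin 3 → ℝ} (hA1 : Differentiable ℝ A1) (i : Fin 3) (p : ℝ × V3) :
    DifferentiableAt ℝ (wcW χ m q c r A1 i) p ∧ pxD i (wcW χ m q c r A1 i) p = 0 := by
  have hd : Differentiable ℝ (wcW χ m q c r A1 i) := by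
    unfold wcW breveA
    fun_prop
  refine ⟨hd p, ?_⟩
  obtain ⟨t, y⟩ := p
  refine wc_pxD_line i (hd _) ?_
  have h2 : HasDerivAt (fun s : ℝ => ∑ k, (A1 t i k - A1 t k i) *
        (y + s • EuclideanSpace.single i (1 : ℝ) : V3) k)
        (∑ k, (A1 t i k - A1 t k i) * (if k = i then 1 else 0)) 0 :=
      HasDerivAt.fun_sum fun k _ => (wc_coord i k y).const_mul _
  have h3 := ((h2.const_mul (1 / 2)).const_mul (q / (χ * c))).const_sub ((m / χ) * deriv r t i)
  refine HasDerivAt.congr_deriv h3 ?_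
  simp

lemma wc_final (χ m q c : ℝ) (hχ : 0 < χ) (hm : 0 < m) (ψ0 : ℝ → ℝ) (G' : ℝ → ℝ)
    (hψ0smooth : ContDiff ℝ 2 fun x : V3 => ψ0 ‖x‖)
    (hsteady : ∀ x : V3, lap3 (fun x' => ψ0 ‖x'‖) x = G' ((ψ0 ‖x‖) ^ 2) * ψ0 ‖x‖)
    (r : ℝ → V3) (hr : Differentiable ℝ r) (hv : Differentiable ℝ (deriv r))
    (A1 : ℝ → Fin 3 → Fin 3 → ℝ) (hA1 : Differentiable ℝ A1)
    (S : ℝ × V3 → ℝ) (hS : Differentiable ℝ S) (AJ : Fin 3 → ℝ × V3 → ℝ)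
    (hW : ∀ p i, pxD i S p - q / (χ * c) * AJ i p = wcW χ m q c r A1 i p)
    (ΦJ : ℝ × V3 → ℝ) (t : ℝ) (x : V3)
    (hHJ : -(ptD S (t, x - r t) - ∑ i, deriv r t i * pxD i S (t, x - r t))
      - (q / χ) * ΦJ (t, x - r t)
      = (χ / (2 * m)) * ∑ i, wcW χ m q c r A1 i (t, x - r t) ^ 2) :
    SatisfiesNLS' χ m q c G' (fun p => ΦJ (p.1, p.2 - r p.1))
      (fun p j => AJ j (p.1, p.2 - r p.1))
      (fun p => (fun z : ℝ × V3 => Complex.exp (Complex.I * ((S z : ℝ) : ℂ)) * ((ψ0 ‖z.2‖ : ℝ) : ℂ))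
        (p.1, p.2 - r p.1)) (t, x) := by
  have hfd : Differentiable ℝ fun x : V3 => ψ0 ‖x‖ := hψ0smooth.differentiable (by norm_num)
  have hf1 : ∀ i, Differentiable ℝ (pxS i (fun x : V3 => ψ0 ‖x‖)) := by
    intro i
    have h1 : ContDiff ℝ 1 (fderiv ℝ (fun x : V3 => ψ0 ‖x‖)) :=
      hψ0smooth.fderiv_right (by norm_num)
    exact (h1.differentiable (by norm_num)).clm_apply (differentiable_const _)
  have hstd := hsteady (x - r t)
  -- orthogonality
  have hrad : ∑ i, wcW χ m q c r A1 i (t, x - r t) * pxS i (fun x : V3 => ψ0 ‖x‖) (x - r t)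
      = (m / χ) * ∑ i, deriv r t i * pxS i (fun x : V3 => ψ0 ‖x‖) (x - r t) := by
    have h0 := wc_radial hfd (x - r t)
      (WithLp.toLp 2 (breveA A1 t (fun k => (x - r t) k))) (by
        simp [PiLp.inner_apply, breveA, Fin.sum_univ_three]
        ring)
    simp only [wcW, Fin.sum_univ_three] at h0 ⊢
    linear_combination (-(q / (χ * c))) * h0
  set f : V3 → ℝ := fun x : V3 => ψ0 ‖x‖ with hf
  set W := wcW χ m q c r A1 with hWdef
  have hWd := fun i p => wc_W_px (χ := χ) (m := m) (q := q) (c := c) hv hA1 i p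
  have hu := fun p => wc_f_lift hfd p
  have hui := fun i p => wc_f_lift (hf1 i) p
  let E : ℝ × V3 → ℂ := fun z => Complex.exp (Complex.I * ((S z : ℝ) : ℂ))
  let Ψ : ℝ × V3 → ℂ := fun z => Complex.exp (Complex.I * ((S z : ℝ) : ℂ)) * ((f z.2 : ℝ) : ℂ)
  let u1 : Fin 3 → ℝ × V3 → ℂ := fun i z =>
    ((pxS i f z.2 : ℝ) : ℂ) + Complex.I * ((W i z : ℝ) : ℂ) * ((f z.2 : ℝ) : ℂ)
  have hΨ := fun p => wc_ptD_exp (hS p) (hu p).1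
  -- first covariant derivative
  have hA : ∀ i, covX χ q c (fun p j => AJ j (p.1, p.2 - r p.1)) i
      (fun p => Ψ (p.1, p.2 - r p.1)) = fun p => (fun z => Complex.exp (Complex.I * ((S z : ℝ) : ℂ))
        * u1 i z) (p.1, p.2 - r p.1) := by
    intro i
    funext p
    obtain ⟨t, x⟩ := p
    have h1 := wc_covX_exp χ q c (fun p j => AJ j p) i (hS (t, x - r t)) (hu (t, x - r t)).1 _
      (hW (t, x - r t) i)
    rw [(hu (t, x - r t)).2.2 i] at h1
    have h2 := (wc_chain (hr t) (hΨ (t, x - r t)).1).2.2 i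
    show _ = Complex.exp (Complex.I * ((S (t, x - r t) : ℝ) : ℂ)) * u1 i (t, x - r t)
    rw [← h1]
    unfold covX
    rw [← h2]
  -- derivative of u1
  have hu1 : ∀ i p, DifferentiableAt ℝ (u1 i) p ∧ pxD i (u1 i) p
      = ((pxS i (pxS i f) p.2 : ℝ) : ℂ)
        + Complex.I * ((W i p : ℝ) : ℂ) * ((pxS i f p.2 : ℝ) : ℂ) := by
    intro i p
    have h1 : HasFDerivAt (fun z => ((W i z : ℝ) : ℂ)) (Complex.ofRealCLM.comp (fderiv ℝ (W i) p)) p :=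
      Complex.ofRealCLM.hasFDerivAt.comp p (hWd i p).1.hasFDerivAt
    have h2 := (hui i p).1.hasFDerivAt.add
      ((h1.const_mul Complex.I).mul (hu p).1.hasFDerivAt)
    refine ⟨h2.differentiableAt, ?_⟩
    have h3 : pxD i (u1 i) p = _ := congrArg (fun L => L (0, EuclideanSpace.single i 1)) h2.fderiv
    have h4 := (hui i p).2.2 i
    have h5 := (hu p).2.2 i
    have h6 := (hWd i p).2
    unfold pxD at h4 h5 h6
    rw [h3]
    simp [h4, h5, h6, hWdef]
  -- second covariant derivative
  have hB : ∀ i, covX χ q c (fun p j => AJ j (p.1, p.2 - r p.1)) i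
      (covX χ q c (fun p j => AJ j (p.1, p.2 - r p.1)) i (fun p => Ψ (p.1, p.2 - r p.1))) (t, x)
      = E (t, x - r t) * (((pxS i (pxS i f) (x - r t) : ℝ) : ℂ)
        + 2 * Complex.I * ((W i (t, x - r t) : ℝ) : ℂ) * ((pxS i f (x - r t) : ℝ) : ℂ)
        - ((W i (t, x - r t) : ℝ) : ℂ) ^ 2 * ((f (x - r t) : ℝ) : ℂ)) := by
    intro i
    rw [hA]
    have h1 := wc_covX_exp χ q c (fun p j => AJ j p) i (hS (t, x - r t)) (hu1 i (t, x - r t)).1 _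
      (hW (t, x - r t) i)
    rw [(hu1 i (t, x - r t)).2] at h1
    have h2 := (wc_chain (hr t) (wc_ptD_exp (hS (t, x - r t)) (hu1 i (t, x - r t)).1).1).2.2 i
    have h3 : covX χ q c (fun p j => AJ j (p.1, p.2 - r p.1)) i
        (fun p => (fun z => Complex.exp (Complex.I * ((S z : ℝ) : ℂ))
        * u1 i z) (p.1, p.2 - r p.1)) (t, x) = covX χ q c (fun p j => AJ j p) i
        (fun z => Complex.exp (Complex.I * ((S z : ℝ) : ℂ)) * u1 i z) (t, x - r t) := by
      unfold covX
      rw [← h2]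
    rw [h3, h1]
    simp only [u1, E, hWdef]
    linear_combination (Complex.exp (Complex.I * ((S (t, x - r t) : ℝ) : ℂ)) *
      ((wcW χ m q c r A1 i (t, x - r t) : ℝ) : ℂ) ^ 2 * ((f (x - r t) : ℝ) : ℂ)) * Complex.I_sq
  -- time derivative
  have hT : ptD (fun p : ℝ × V3 => Ψ (p.1, p.2 - r p.1)) (t, x)
      = E (t, x - r t) * (Complex.I * ((ptD S (t, x - r t) : ℝ) : ℂ) * ((f (x - r t) : ℝ) : ℂ)
        - ∑ i, ((deriv r t i : ℝ) : ℂ) * (((pxS i f (x - r t) : ℝ) : ℂ)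
          + Complex.I * ((pxD i S (t, x - r t) : ℝ) : ℂ) * ((f (x - r t) : ℝ) : ℂ))) := by
    rw [(wc_chain (hr t) (hΨ (t, x - r t)).1).2.1, (hΨ (t, x - r t)).2.1]
    simp only [(hΨ (t, x - r t)).2.2, (hu (t, x - r t)).2.1, (hu (t, x - r t)).2.2,
      Complex.real_smul, Fin.sum_univ_three, E]
    ring
  have hN : Complex.normSq (Ψ (t, x - r t)) = f (x - r t) ^ 2 := by
    simp only [Ψ]
    rw [Complex.normSq_mul, Complex.normSq_eq_norm_sq, Complex.norm_exp_I_mul_ofReal,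
      Complex.normSq_ofReal]
    ring
  show SatisfiesNLS' χ m q c G' (fun p => ΦJ (p.1, p.2 - r p.1))
      (fun p j => AJ j (p.1, p.2 - r p.1)) (fun p => Ψ (p.1, p.2 - r p.1)) (t, x)
  unfold SatisfiesNLS' covT
  rw [hT]
  simp only [hB, hN]
  have hΨE : Ψ (t, x - r t) = E (t, x - r t) * ((f (x - r t) : ℝ) : ℂ) := rfl
  rw [hΨE]
  have hst : lap3 f (x - r t) = G' (f (x - r t) ^ 2) * f (x - r t) := hstd
  unfold lap3 at hst
  have c1 := congrArg (fun a : ℝ => (a : ℂ)) hHJ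
  have c2 := congrArg (fun a : ℝ => (a : ℂ)) hrad
  have c3 := congrArg (fun a : ℝ => (a : ℂ)) hst
  have hχ' : (χ : ℂ) ≠ 0 := by exact_mod_cast hχ.ne'
  have hm' : (m : ℂ) ≠ 0 := by exact_mod_cast hm.ne'
  have hk : ((χ / (2 * m) : ℝ) : ℂ) * ((m / χ : ℝ) : ℂ) = 1 / 2 := by
    push_cast
    field_simp
  simp only [Fin.sum_univ_three, Complex.ofReal_add, Complex.ofReal_sub, Complex.ofReal_mul,
    Complex.ofReal_neg, Complex.ofReal_pow] at c1 c2 c3 ⊢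
  generalize ((χ / (2 * m) : ℝ) : ℂ) = k at *
  generalize ((m / χ : ℝ) : ℂ) = l at *
  generalize ((q / χ : ℝ) : ℂ) = n at *
  generalize E (t, x - r t) = e at *
  linear_combination (e * ((f (x - r t) : ℝ) : ℂ)) * c1 + (k * e) * c3 + (2 * Complex.I * k * e) * c2
    + (2 * Complex.I * e * (((deriv r t 0 : ℝ) : ℂ) * ((pxS 0 f (x - r t) : ℝ) : ℂ) + ((deriv r t 1 : ℝ) : ℂ) * ((pxS 1 f (x - r t) : ℝ) : ℂ) + ((deriv r t 2 : ℝ) : ℂ) * ((pxS 2 f (x - r t) : ℝ) : ℂ))) * hk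
    + (e * ((f (x - r t) : ℝ) : ℂ) * (((ptD S (t, x - r t) : ℝ) : ℂ)
      - (((deriv r t 0 : ℝ) : ℂ) * ((pxD 0 S (t, x - r t) : ℝ) : ℂ) + ((deriv r t 1 : ℝ) : ℂ) * ((pxD 1 S (t, x - r t) : ℝ) : ℂ) + ((deriv r t 2 : ℝ) : ℂ) * ((pxD 2 S (t, x - r t) : ℝ) : ℂ))
      + n * ((ΦJ (t, x - r t) : ℝ) : ℂ))) * Complex.I_sq

/-- **wave-corpuscle.** Let `ψ̊` be a positive, square-integrable, `C²`
radial form factor solving the steady-state equation `Δψ̊ = G'(ψ̊²)ψ̊`, and let the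
potentials have the special moving-frame form
`φ = φ₀ + y·φ₁ + φ₂`, `A = A₀ + A₁ y + ∇_y P₃` with the compatible quadratic part `φ₂`,
where `P₃(t,·)` is positively homogeneous of degree `3`. If the trajectory `r(t)`
satisfies Newton's law with the Lorentz force of these potentials, then the
wave-corpuscle `ψ = e^{iS(t, x − r(t))} ψ̊(|x − r(t)|)` with the phase `S` constructed
above is an exact solution of the NLS equation `i∂̃_tψ = (χ/(2m))(−∇̃²ψ + G'(|ψ|²)ψ)`. -/
theorem statement9
    (χ m q c : ℝ) (hχ : 0 < χ) (hm : 0 < m) (hq : 0 < q) (hc : 0 < c)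
    (ψ0 : ℝ → ℝ) (G' : ℝ → ℝ)
    (hψ0pos : ∀ s : ℝ, 0 ≤ s → 0 < ψ0 s)
    (hψ0smooth : ContDiff ℝ 2 fun x : V3 => ψ0 ‖x‖)
    (hψ0int : Integrable fun x : V3 => (ψ0 ‖x‖) ^ 2)
    (hsteady : ∀ x : V3, lap3 (fun x' => ψ0 ‖x'‖) x = G' ((ψ0 ‖x‖) ^ 2) * ψ0 ‖x‖)
    (hG'cont : ∃ s : Set ℝ, IsOpen s ∧ (∀ x : V3, (ψ0 ‖x‖) ^ 2 ∈ s) ∧ ContinuousOn G' s)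
    (r : ℝ → V3) (hr : ContDiff ℝ 2 r)
    (φ0 : ℝ → ℝ) (φ1 : ℝ → Fin 3 → ℝ) (A0 : ℝ → Fin 3 → ℝ)
    (A1 : ℝ → Fin 3 → Fin 3 → ℝ) (P3 : ℝ → V3 → ℝ)
    (hφ0 : ContDiff ℝ 1 φ0) (hφ1 : ContDiff ℝ 1 φ1)
    (hA0 : ContDiff ℝ 1 A0) (hA1 : ContDiff ℝ 1 A1)
    (hP3hom : ∀ t : ℝ, ∀ ζ > (0 : ℝ), ∀ y : V3, P3 t (ζ • y) = ζ ^ 3 * P3 t y)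
    (hP3diff : Differentiable ℝ fun p : ℝ × V3 => P3 p.1 p.2)
    (hgradP3 : ContDiff ℝ 1 fun p : ℝ × V3 => (fun j => pxS j (P3 p.1) p.2))
    (hNewton : ∀ t : ℝ, ∀ j : Fin 3,
      m * deriv (deriv r) t j
        = q * ED c (phiWC m q c r φ0 φ1 A1 P3) (AWC r A0 A1 P3) (t, r t) j
          + (q / c) * cross3 (fun i => deriv r t i)
              (BD (AWC r A0 A1 P3) (t, r t)) j) :
    ∀ p : ℝ × V3, SatisfiesNLS' χ m q c G' (phiWC m q c r φ0 φ1 A1 P3)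
      (AWC r A0 A1 P3) (psiWC χ m q c r φ0 A0 A1 P3 ψ0) p := by
  have hr1 : Differentiable ℝ r := hr.differentiable (by norm_num)
  have hv1 : ContDiff ℝ 1 (deriv r) := by
    have h2 : ContDiff ℝ (1 + 1) r := by simpa [one_add_one_eq_two] using hr
    exact (contDiff_succ_iff_deriv.1 h2).2.2
  have hv : Differentiable ℝ (deriv r) := hv1.differentiable (by norm_num)
  have hφ0d : Differentiable ℝ φ0 := hφ0.differentiable (by norm_num)
  have hφ1d : Differentiable ℝ φ1 := hφ1.differentiable (by norm_num)
  have hA0d : Differentiable ℝ A0 := hA0.differentiable (by norm_num)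
  have hA1d : Differentiable ℝ A1 := hA1.differentiable (by norm_num)
  rintro ⟨t, x⟩
  have hHJ := wc_HJ hχ hm hc hr1 hv hφ0d hφ1d hA0d hA1 hP3hom hP3diff hgradP3 hNewton t (x - r t)
  have hSd := (wc_S_deriv (m := m) (q := q) hχ hc hv hφ0.continuous hA0d hA1d hP3hom hP3diff
    hgradP3).1
  have hW := wc_W_eq (m := m) (q := q) hχ hc hv hφ0.continuous hA0d hA1d hP3hom hP3diff hgradP3
  exact wc_final χ m q c hχ hm ψ0 G' hψ0smooth hsteady r hr1 hv A1 hA1d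
    (fun p : ℝ × V3 => SWC χ m q c r φ0 A0 A1 P3 p.1 p.2) hSd (wcAJ A0 A1 P3) hW
    (wcPhiJ m q c r φ0 φ1 A1 P3) t x hHJ


end
end

section
/- Let j ≥ 0 be an integer and let V : ℝ³ → ℝ³ be continuously differentiable and positively homogeneous of degree j, i.e. V(ζy) = ζʲV(y) for all ζ > 0 and y ∈ ℝ³. Define P(y) = (1/(j+1)) y·V(y). Then ∇P(y) = V(y) + (1/(j+1)) y × (∇×V)(y) for all y, and consequently the sphere-tangent part V̆ := V − ∇P of the splitting of V satisfies V̆(y) = −(1/(j+1)) y × (∇×V)(y), which indeed obeys V̆(y)·y = 0 for all y. -/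
noncomputable section
open MeasureTheory Complex Filter Topology Metric

/-- Spatial gradient of a scalar function on `ℝ³`. -/
def gradS (f : V3 → ℝ) (y : V3) : Fin 3 → ℝ := fun i => pxS i f y

/-- Curl of a vector field on `ℝ³`. -/
def curlS (V : V3 → Fin 3 → ℝ) (y : V3) : Fin 3 → ℝ :=
  ![pxS 1 V y 2 - pxS 2 V y 1, pxS 2 V y 0 - pxS 0 V y 2, pxS 0 V y 1 - pxS 1 V y 0]

/-- For a `C¹` vector field `V`, positively homogeneous of degree `j`,
and `P(y) = (1/(j+1)) y·V(y)`, one has `∇P = V + (1/(j+1)) y × (∇×V)`; hence the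
sphere-tangent part `V̆ = V − ∇P` equals `−(1/(j+1)) y × (∇×V)`, which satisfies
`V̆(y)·y = 0`. -/
theorem statement14 (j : ℕ) (V : V3 → Fin 3 → ℝ) (hV : ContDiff ℝ 1 V)
    (hhom : ∀ ζ : ℝ, 0 < ζ → ∀ y : V3, V (ζ • y) = ζ ^ j • V y) :
    (∀ y : V3, ∀ i : Fin 3,
      gradS (fun y' => ((j : ℝ) + 1)⁻¹ * dot3 (fun k => y' k) (V y')) y i
        = V y i + ((j : ℝ) + 1)⁻¹ * cross3 (fun k => y k) (curlS V y) i) ∧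
    (∀ y : V3, ∀ i : Fin 3,
      V y i - gradS (fun y' => ((j : ℝ) + 1)⁻¹ * dot3 (fun k => y' k) (V y')) y i
        = -(((j : ℝ) + 1)⁻¹) * cross3 (fun k => y k) (curlS V y) i) ∧
    (∀ y : V3,
      dot3 (fun i => -(((j : ℝ) + 1)⁻¹) * cross3 (fun k => y k) (curlS V y) i)
        (fun i => y i) = 0) := by
  have hd : ∀ y, DifferentiableAt ℝ V y := fun y => (hV.differentiable (by norm_num)) y
  have euler : ∀ y : V3, ∀ l : Fin 3,
      y 0 * pxS 0 V y l + y 1 * pxS 1 V y l + y 2 * pxS 2 V y l = j * V y l := by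
    intro y l
    have h1 : HasDerivAt (fun ζ : ℝ => V (ζ • y)) (fderiv ℝ V y y) 1 := by
      have ha : HasDerivAt (fun ζ : ℝ => ζ • y) y 1 := by
        simpa using (hasDerivAt_id (1 : ℝ)).smul_const y
      have hb : HasFDerivAt V (fderiv ℝ V y) ((1 : ℝ) • y) := by
        rw [one_smul]; exact (hd y).hasFDerivAt
      exact hb.comp_hasDerivAt (1 : ℝ) ha
    have h2 : HasDerivAt (fun ζ : ℝ => ζ ^ j • V y) ((j : ℝ) • V y) 1 := by
      simpa using (hasDerivAt_pow j (1 : ℝ)).smul_const (V y)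
    have heq : (fun ζ : ℝ => V (ζ • y)) =ᶠ[𝓝 1] (fun ζ : ℝ => ζ ^ j • V y) := by
      filter_upwards [lt_mem_nhds (zero_lt_one : (0 : ℝ) < 1)] with ζ hζ
      exact hhom ζ hζ y
    have h3 : fderiv ℝ V y y = (j : ℝ) • V y :=
      h1.unique (h2.congr_of_eventuallyEq heq)
    have hy : y = y 0 • EuclideanSpace.single (0 : Fin 3) (1 : ℝ)
        + y 1 • EuclideanSpace.single (1 : Fin 3) (1 : ℝ)
        + y 2 • EuclideanSpace.single (2 : Fin 3) (1 : ℝ) := by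
      ext k
      fin_cases k <;> simp
    have h4 : fderiv ℝ V y y = y 0 • pxS 0 V y + y 1 • pxS 1 V y + y 2 • pxS 2 V y := by
      have h5 := congrArg (fderiv ℝ V y) hy
      rw [map_add, map_add, map_smul, map_smul, map_smul] at h5
      exact h5
    have h6 := congrFun (h4.symm.trans h3) l
    simpa using h6
  have grad : ∀ y : V3, ∀ i : Fin 3,
      gradS (fun y' => ((j : ℝ) + 1)⁻¹ * dot3 (fun k => y' k) (V y')) y i
        = ((j : ℝ) + 1)⁻¹ * (V y i + ∑ k, y k * pxS i V y k) := by
    intro y i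
    have hc : ∀ k : Fin 3, HasFDerivAt (fun y' : V3 => y' k)
        (EuclideanSpace.proj k : V3 →L[ℝ] ℝ) y := fun k =>
      (EuclideanSpace.proj k : V3 →L[ℝ] ℝ).hasFDerivAt
    have hv : ∀ k : Fin 3, HasFDerivAt (fun y' : V3 => V y' k)
        ((ContinuousLinearMap.proj k : (Fin 3 → ℝ) →L[ℝ] ℝ).comp (fderiv ℝ V y)) y := fun k =>
      (ContinuousLinearMap.proj k : (Fin 3 → ℝ) →L[ℝ] ℝ).hasFDerivAt.comp y (hd y).hasFDerivAt
    have hP := (HasFDerivAt.fun_sum (u := Finset.univ)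
      (fun k _ => (hc k).mul (hv k))).const_mul (((j : ℝ) + 1)⁻¹)
    unfold gradS
    rw [pxS]
    unfold dot3
    refine (congrArg (fun L : V3 →L[ℝ] ℝ => L (EuclideanSpace.single i 1)) hP.fderiv).trans ?_
    fin_cases i <;> simp [Fin.sum_univ_three, pxS] <;> ring
  have hj : ((j : ℝ) + 1) ≠ 0 := by positivity
  have main : ∀ y : V3, ∀ i : Fin 3,
      gradS (fun y' => ((j : ℝ) + 1)⁻¹ * dot3 (fun k => y' k) (V y')) y i
        = V y i + ((j : ℝ) + 1)⁻¹ * cross3 (fun k => y k) (curlS V y) i := by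
    intro y i
    rw [grad]
    have e := euler y i
    field_simp
    fin_cases i <;> simp [Fin.sum_univ_three, cross3, curlS] at e ⊢ <;> linarith
  refine ⟨main, fun y i => ?_, fun y => ?_⟩
  · rw [main]; ring
  · simp [dot3, cross3, Fin.sum_univ_three]; ring

end
end
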